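/- For an antisymmetric CM-DMBC satisfying the standing assumptions (unique CAID and C_k > C for k = 1,2), the directional derivatives at the CAID satisfy ∇I₁(v) + ∇I₂(v) = 0 for every v ∈ ℝ₀^{𝒳}; consequently the constant η of Lemma 1 equals 1/2. -/

import Mathlib

open Finset

noncomputable section

variable {𝒳 𝒴 : Type*} [Fintype 𝒳] [Fintype 𝒴]

/-- `P` is a probability distribution on the finite alphabet `𝒳`. -/
def IsDist (P : 𝒳 → ℝ) : Prop := (∀ x, 0 ≤ P x) ∧ ∑ x, P x = 1

/-- The output distribution `PW` induced by input distribution `P` and channel `W`. -/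
def outDist (P : 𝒳 → ℝ) (W : 𝒳 → 𝒴 → ℝ) (y : 𝒴) : ℝ := ∑ x, P x * W x y

/-- The mutual information `I(P, W)` (natural logarithm). -/
def mutInfo (P : 𝒳 → ℝ) (W : 𝒳 → 𝒴 → ℝ) : ℝ :=
  ∑ x, ∑ y, P x * W x y * Real.log (W x y / outDist P W y)

/-- Relative entropy (KL divergence) between two pmfs on a finite alphabet. -/
def relEnt (p q : 𝒴 → ℝ) : ℝ := ∑ y, p y * Real.log (p y / q y)

/-- Directional derivative `∇I_k(v)` of the mutual information at `P*` along `v`. -/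
def gradI (Pstar : 𝒳 → ℝ) (W : 𝒳 → 𝒴 → ℝ) (v : 𝒳 → ℝ) : ℝ :=
  ∑ x, v x * relEnt (W x) (outDist Pstar W)


/-- A weakly symmetric stochastic matrix with `N` rows, supported on the output
set `S`: nonnegative entries, rows supported on `S` summing to one, each row a
permutation (within `S`) of any other row, and all column sums over `S` equal. -/
def WeaklySymmetricOn (S : Finset 𝒴) (N : ℕ) (Mtx : Fin N → 𝒴 → ℝ) : Prop :=
  (∀ u y, 0 ≤ Mtx u y) ∧
  (∀ u y, y ∉ S → Mtx u y = 0) ∧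
  (∀ u, ∑ y ∈ S, Mtx u y = 1) ∧
  (∀ u u', ∃ σ : 𝒴 ≃ 𝒴, (∀ y ∈ S, σ y ∈ S) ∧ ∀ y ∈ S, Mtx u' (σ y) = Mtx u y) ∧
  (∀ y ∈ S, ∀ y' ∈ S, ∑ u, Mtx u y = ∑ u, Mtx u y')

/-- The uniform input distribution on `𝒳 = Fin 2 × Fin N` (an alphabet of size `2N`). -/
def unifDist (N : ℕ) : Fin 2 × Fin N → ℝ := fun _ => 1 / (2 * N)

/-- The mutual information is at most the average relative entropy of the channel rows to any
output distribution `q` dominating them. -/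
theorem mutInfo_le_sum_relEnt {P : 𝒳 → ℝ} {W : 𝒳 → 𝒴 → ℝ} {q : 𝒴 → ℝ} (hP : IsDist P)
    (hW : ∀ x y, 0 ≤ W x y) (hWsum : ∀ x, ∑ y, W x y = 1) (hq : ∀ y, 0 ≤ q y)
    (hqsum : ∑ y, q y = 1) (hdom : ∀ x y, 0 < W x y → 0 < q y) :
    mutInfo P W ≤ ∑ x, P x * relEnt (W x) q := by
  have hterm : ∀ x y, P x * W x y * Real.log (W x y / outDist P W y) ≤
      P x * W x y * Real.log (W x y / q y) - P x * W x y +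
        P x * W x y * (q y / outDist P W y) := by
    intro x y
    have hnn : ∀ z, 0 ≤ P z * W z y := fun z => mul_nonneg (hP.1 z) (hW z y)
    rcases (hnn x).eq_or_lt with h0 | h0
    · simp [← h0]
    · have hWpos : 0 < W x y := (hW x y).lt_of_ne fun h => by simp [← h] at h0
      have hqpos := hdom x y hWpos
      have hout : 0 < outDist P W y :=
        h0.trans_le (Finset.single_le_sum (fun z _ => hnn z) (Finset.mem_univ x))
      have hlog : Real.log (W x y / outDist P W y) =
          Real.log (W x y / q y) + Real.log (q y / outDist P W y) := by
        rw [← Real.log_mul (by positivity) (by positivity)]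
        congr 1
        field_simp
      have hle := Real.log_le_sub_one_of_pos (div_pos hqpos hout)
      rw [hlog]
      nlinarith [mul_le_mul_of_nonneg_left hle h0.le]
  have hone : ∑ x, ∑ y, P x * W x y = 1 := by
    simp_rw [← Finset.mul_sum, hWsum, mul_one]
    exact hP.2
  have hratio : ∑ x, ∑ y, P x * W x y * (q y / outDist P W y) ≤ 1 := by
    rw [Finset.sum_comm, ← hqsum]
    refine Finset.sum_le_sum fun y _ => ?_
    rw [← Finset.sum_mul]
    change outDist P W y * (q y / outDist P W y) ≤ q y
    by_cases h : outDist P W y = 0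
    · simpa [h] using hq y
    · rw [mul_div_cancel₀ _ h]
  calc mutInfo P W ≤ ∑ x, ∑ y, (P x * W x y * Real.log (W x y / q y) - P x * W x y +
        P x * W x y * (q y / outDist P W y)) :=
        Finset.sum_le_sum fun x _ => Finset.sum_le_sum fun y _ => hterm x y
    _ = ∑ x, P x * relEnt (W x) q - ∑ x, ∑ y, P x * W x y +
        ∑ x, ∑ y, P x * W x y * (q y / outDist P W y) := by
        simp only [Finset.sum_add_distrib, Finset.sum_sub_distrib, relEnt, Finset.mul_sum,
          mul_assoc]
    _ ≤ ∑ x, P x * relEnt (W x) q := by linarith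

theorem mutInfo_eq_sum_relEnt (P : 𝒳 → ℝ) (W : 𝒳 → 𝒴 → ℝ) :
    mutInfo P W = ∑ x, P x * relEnt (W x) (outDist P W) := by
  simp only [mutInfo, relEnt, Finset.mul_sum, mul_assoc]

/-- Mutual information is at most `D` if all channel rows have relative entropy at most `D` to a
common dominating output distribution. -/
theorem mutInfo_le_of_relEnt_le {P : 𝒳 → ℝ} {W : 𝒳 → 𝒴 → ℝ} {q : 𝒴 → ℝ} {D : ℝ} (hP : IsDist P)
    (hW : ∀ x y, 0 ≤ W x y) (hWsum : ∀ x, ∑ y, W x y = 1) (hq : ∀ y, 0 ≤ q y)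
    (hqsum : ∑ y, q y = 1) (hdom : ∀ x y, 0 < W x y → 0 < q y)
    (hD : ∀ x, relEnt (W x) q ≤ D) : mutInfo P W ≤ D :=
  calc mutInfo P W ≤ ∑ x, P x * relEnt (W x) q :=
        mutInfo_le_sum_relEnt hP hW hWsum hq hqsum hdom
    _ ≤ ∑ x, P x * D :=
        Finset.sum_le_sum fun x _ => mul_le_mul_of_nonneg_left (hD x) (hP.1 x)
    _ = D := by rw [← Finset.sum_mul, hP.2, one_mul]

/-- Any function of the entries has the same sum along all rows of a weakly symmetric matrix. -/
theorem WeaklySymmetricOn.sum_comp_eq {β : Type*} {S : Finset β} {N : ℕ} {M : Fin N → β → ℝ}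
    (h : WeaklySymmetricOn S N M) (f : ℝ → ℝ) (u u' : Fin N) :
    ∑ y ∈ S, f (M u y) = ∑ y ∈ S, f (M u' y) := by
  obtain ⟨σ, hσ, hM⟩ := h.2.2.2.1 u u'
  exact Finset.sum_nbij σ hσ σ.injective.injOn
    (Finset.surjOn_of_injOn_of_card_le σ hσ σ.injective.injOn le_rfl)
    fun y hy => by rw [hM y hy]

section Blocks

variable {N r : ℕ} {part : 𝒴 → Fin r} {w : Fin r → ℝ} {B : Fin r → Fin N → 𝒴 → ℝ}

/-- The rows of a weighted concatenation of weakly symmetric blocks sum to the total weight. -/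
theorem sum_weighted_blocks
    (hB : ∀ j, WeaklySymmetricOn (Finset.univ.filter fun y => part y = j) N (B j)) (u : Fin N) :
    ∑ y, w (part y) * B (part y) u y = ∑ j, w j := by
  rw [← Finset.sum_fiberwise Finset.univ part]
  refine Finset.sum_congr rfl fun j _ => ?_
  calc _ = ∑ y ∈ Finset.univ.filter (fun y => part y = j), w j * B j u y :=
        Finset.sum_congr rfl fun y hy => by rw [(Finset.mem_filter.mp hy).2]
    _ = w j := by rw [← Finset.mul_sum, (hB j).2.2.1 u, mul_one]

/-- All rows of a weighted concatenation of weakly symmetric blocks have the same relative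
entropy to an output distribution that is constant on each part. -/
theorem relEnt_weighted_blocks_eq {q : 𝒴 → ℝ}
    (hB : ∀ j, WeaklySymmetricOn (Finset.univ.filter fun y => part y = j) N (B j))
    (hq : ∀ y y', part y = part y' → q y = q y') (u u' : Fin N) :
    relEnt (fun y => w (part y) * B (part y) u y) q =
      relEnt (fun y => w (part y) * B (part y) u' y) q := by
  simp only [relEnt]
  rw [← Finset.sum_fiberwise Finset.univ part, ← Finset.sum_fiberwise Finset.univ part]
  refine Finset.sum_congr rfl fun j _ => ?_
  rcases (Finset.univ.filter fun y => part y = j).eq_empty_or_nonempty with he | ⟨y₀, hy₀⟩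
  · simp [he]
  · have hrow : ∀ t, ∑ y ∈ Finset.univ.filter (fun y => part y = j),
        w (part y) * B (part y) t y * Real.log (w (part y) * B (part y) t y / q y) =
        ∑ y ∈ Finset.univ.filter (fun y => part y = j),
          (fun b => w j * b * Real.log (w j * b / q y₀)) (B j t y) := fun t =>
      Finset.sum_congr rfl fun y hy => by
        rw [hq y y₀ (by rw [(Finset.mem_filter.mp hy).2, (Finset.mem_filter.mp hy₀).2]),
          (Finset.mem_filter.mp hy).2]
    rw [hrow, hrow]
    exact (hB j).sum_comp_eq (fun b => w j * b * Real.log (w j * b / q y₀)) u u'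

/-- The column sums of a weighted concatenation of weakly symmetric blocks are constant on
each part. -/
theorem sum_column_weighted_blocks_eq
    (hB : ∀ j, WeaklySymmetricOn (Finset.univ.filter fun y => part y = j) N (B j)) {y y' : 𝒴}
    (h : part y = part y') :
    ∑ u, w (part y) * B (part y) u y = ∑ u, w (part y') * B (part y') u y' := by
  rw [h, ← Finset.mul_sum, ← Finset.mul_sum,
    (hB (part y')).2.2.2.2 y (by simp [h]) y' (by simp)]

end Blocks

theorem isDist_unifDist {N : ℕ} (hN : 0 < N) : IsDist (unifDist N) := by
  refine ⟨fun x => by unfold unifDist; positivity, ?_⟩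
  have : (N : ℝ) ≠ 0 := by positivity
  simp only [unifDist, Finset.sum_const, Finset.card_univ, Fintype.card_prod, Fintype.card_fin,
    nsmul_eq_mul, Nat.cast_mul, Nat.cast_ofNat]
  field_simp

theorem outDist_unifDist {β : Type*} {N : ℕ} (W : Fin 2 × Fin N → β → ℝ) (y : β) :
    outDist (unifDist N) W y = 1 / (2 * N) * (∑ u, W (0, u) y + ∑ u, W (1, u) y) := by
  simp only [outDist, unifDist, ← Finset.mul_sum, Fintype.sum_prod_type, Fin.sum_univ_two]

/-- For an antisymmetric CM-DMBC satisfying the standing assumptions,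
`∇I₁(v) + ∇I₂(v) = 0` for every `v` summing to zero; consequently the constant
`η` of Lemma 1 equals `1/2`. -/
theorem antisymmetric_eta_half
    (N r : ℕ) (hN : 0 < N)
    (W1 W2 : Fin 2 × Fin N → 𝒴 → ℝ)
    (part : 𝒴 → Fin r) (p : Fin 2 → Fin r → ℝ)
    (Wb : Fin 2 → Fin r → Fin N → 𝒴 → ℝ)
    (hp : ∀ k j, 0 ≤ p k j) (hpsum : ∀ k, ∑ j, p k j = 1)
    (hWb : ∀ k j, WeaklySymmetricOn (Finset.univ.filter fun y => part y = j) N (Wb k j))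
    (hW1a : ∀ u y, W1 (0, u) y = p 0 (part y) * Wb 0 (part y) u y)
    (hW1b : ∀ u y, W1 (1, u) y = p 1 (part y) * Wb 1 (part y) u y)
    (hW2a : ∀ u y, W2 (0, u) y = p 1 (part y) * Wb 1 (part y) u y)
    (hW2b : ∀ u y, W2 (1, u) y = p 0 (part y) * Wb 0 (part y) u y)
    (Pstar : Fin 2 × Fin N → ℝ) (C C1 C2 : ℝ)
    (hPstar : IsDist Pstar) (hPpos : ∀ x, 0 < Pstar x)
    (hCach : min (mutInfo Pstar W1) (mutInfo Pstar W2) = C)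
    (hCmax : ∀ P, IsDist P → min (mutInfo P W1) (mutInfo P W2) ≤ C)
    (hUniq : ∀ P, IsDist P → min (mutInfo P W1) (mutInfo P W2) = C → P = Pstar)
    (hC1 : IsLUB {s | ∃ P, IsDist P ∧ s = mutInfo P W1} C1)
    (hC2 : IsLUB {s | ∃ P, IsDist P ∧ s = mutInfo P W2} C2)
    (hC1gt : C < C1) (hC2gt : C < C2)
    :
    (∀ v : Fin 2 × Fin N → ℝ, ∑ x, v x = 0 →
        gradI Pstar W1 v + gradI Pstar W2 v = 0) ∧
    (∀ η : ℝ, η ∈ Set.Ioo (0 : ℝ) 1 →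
        (∀ v : Fin 2 × Fin N → ℝ, ∑ x, v x = 0 →
            η * gradI Pstar W1 v + (1 - η) * gradI Pstar W2 v = 0) →
        η = 1 / 2) := by
  set q := outDist (unifDist N) W1 with hqdef
  have hU := isDist_unifDist hN
  have hUpos : ∀ x, 0 < unifDist N x := fun x => by unfold unifDist; positivity
  have hq2 : outDist (unifDist N) W2 = q := by
    funext y
    simp only [hqdef, outDist_unifDist, hW1a, hW1b, hW2a, hW2b]
    ring
  have hW1 : ∀ x y, 0 ≤ W1 x y := by
    rintro ⟨k, u⟩ y
    fin_cases k
    · exact (mul_nonneg (hp _ _) ((hWb _ _).1 _ _)).trans_eq (hW1a u y).symm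
    · exact (mul_nonneg (hp _ _) ((hWb _ _).1 _ _)).trans_eq (hW1b u y).symm
  have hW2 : ∀ x y, 0 ≤ W2 x y := by
    rintro ⟨k, u⟩ y
    fin_cases k
    · exact (mul_nonneg (hp _ _) ((hWb _ _).1 _ _)).trans_eq (hW2a u y).symm
    · exact (mul_nonneg (hp _ _) ((hWb _ _).1 _ _)).trans_eq (hW2b u y).symm
  have hrow : ∀ k u, ∑ y, p k (part y) * Wb k (part y) u y = 1 := fun k u =>
    (sum_weighted_blocks (hWb k) u).trans (hpsum k)
  have hW1sum : ∀ x, ∑ y, W1 x y = 1 := by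
    rintro ⟨k, u⟩
    fin_cases k
    · exact (Finset.sum_congr rfl fun y _ => hW1a u y).trans (hrow 0 u)
    · exact (Finset.sum_congr rfl fun y _ => hW1b u y).trans (hrow 1 u)
  have hW2sum : ∀ x, ∑ y, W2 x y = 1 := by
    rintro ⟨k, u⟩
    fin_cases k
    · exact (Finset.sum_congr rfl fun y _ => hW2a u y).trans (hrow 1 u)
    · exact (Finset.sum_congr rfl fun y _ => hW2b u y).trans (hrow 0 u)
  have hq : ∀ y, 0 ≤ q y := fun y =>
    Finset.sum_nonneg fun x _ => mul_nonneg (hU.1 x) (hW1 x y)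
  have hqsum : ∑ y, q y = 1 := by
    simp only [hqdef, outDist]
    rw [Finset.sum_comm]
    simp_rw [← Finset.mul_sum, hW1sum, mul_one]
    exact hU.2
  have hdom1 : ∀ x y, 0 < W1 x y → 0 < q y := fun x y h =>
    (mul_pos (hUpos x) h).trans_le (Finset.single_le_sum
      (f := fun z => unifDist N z * W1 z y)
      (fun z _ => mul_nonneg (hU.1 z) (hW1 z y)) (Finset.mem_univ x))
  have hdom2 : ∀ x y, 0 < W2 x y → 0 < q y := fun x y h => by
    rw [← hq2]
    exact (mul_pos (hUpos x) h).trans_le (Finset.single_le_sum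
      (f := fun z => unifDist N z * W2 z y)
      (fun z _ => mul_nonneg (hU.1 z) (hW2 z y)) (Finset.mem_univ x))
  have hqpart : ∀ y y', part y = part y' → q y = q y' := fun y y' h => by
    simp only [hqdef, outDist_unifDist, hW1a, hW1b]
    rw [sum_column_weighted_blocks_eq (hWb 0) h, sum_column_weighted_blocks_eq (hWb 1) h]
  obtain ⟨D, hD⟩ : ∃ D : Fin 2 → ℝ, ∀ k u,
      relEnt (fun y => p k (part y) * Wb k (part y) u y) q = D k :=
    ⟨fun k => relEnt (fun y => p k (part y) * Wb k (part y) ⟨0, hN⟩ y) q,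
      fun k u => relEnt_weighted_blocks_eq (hWb k) hqpart u _⟩
  have hD1a : ∀ u, relEnt (W1 (0, u)) q = D 0 := fun u => by rw [funext (hW1a u), hD]
  have hD1b : ∀ u, relEnt (W1 (1, u)) q = D 1 := fun u => by rw [funext (hW1b u), hD]
  have hD2a : ∀ u, relEnt (W2 (0, u)) q = D 1 := fun u => by rw [funext (hW2a u), hD]
  have hD2b : ∀ u, relEnt (W2 (1, u)) q = D 0 := fun u => by rw [funext (hW2b u), hD]
  have havg1 : ∀ f : Fin 2 × Fin N → ℝ, ∑ x, f x * relEnt (W1 x) q =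
      (∑ u, f (0, u)) * D 0 + (∑ u, f (1, u)) * D 1 := fun f => by
    simp only [Fintype.sum_prod_type, Fin.sum_univ_two, hD1a, hD1b, Finset.sum_mul]
  have havg2 : ∀ f : Fin 2 × Fin N → ℝ, ∑ x, f x * relEnt (W2 x) q =
      (∑ u, f (0, u)) * D 1 + (∑ u, f (1, u)) * D 0 := fun f => by
    simp only [Fintype.sum_prod_type, Fin.sum_univ_two, hD2a, hD2b, Finset.sum_mul]
  have hsplit : ∀ f : Fin 2 × Fin N → ℝ, ∑ x, f x = ∑ u, f (0, u) + ∑ u, f (1, u) := fun f => by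
    simp only [Fintype.sum_prod_type, Fin.sum_univ_two]
  have hhalf : ∀ k : Fin 2, ∑ u, unifDist N (k, u) = 1 / 2 := fun k => by
    have : (N : ℝ) ≠ 0 := by positivity
    simp only [unifDist, Finset.sum_const, Finset.card_univ, Fintype.card_fin, nsmul_eq_mul]
    field_simp
  have hI1 : mutInfo (unifDist N) W1 = (D 0 + D 1) / 2 := by
    rw [mutInfo_eq_sum_relEnt, ← hqdef, havg1, hhalf, hhalf]
    ring
  have hI2 : mutInfo (unifDist N) W2 = (D 0 + D 1) / 2 := by
    rw [mutInfo_eq_sum_relEnt, hq2, havg2, hhalf, hhalf]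
    ring
  have hCle : C ≤ (D 0 + D 1) / 2 := by
    have h1 := mutInfo_le_sum_relEnt hPstar hW1 hW1sum hq hqsum hdom1
    have h2 := mutInfo_le_sum_relEnt hPstar hW2 hW2sum hq hqsum hdom2
    rw [havg1] at h1
    rw [havg2] at h2
    have hs := (hsplit Pstar).symm.trans hPstar.2
    have hl := min_le_left (mutInfo Pstar W1) (mutInfo Pstar W2)
    have hr := min_le_right (mutInfo Pstar W1) (mutInfo Pstar W2)
    have hsD : (∑ u, Pstar (0, u) + ∑ u, Pstar (1, u)) * (D 0 + D 1) = D 0 + D 1 := by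
      rw [hs, one_mul]
    linarith
  have hUC : min (mutInfo (unifDist N) W1) (mutInfo (unifDist N) W2) = C :=
    le_antisymm (hCmax _ hU) (by rw [hI1, hI2, min_self]; exact hCle)
  have hPU : unifDist N = Pstar := hUniq _ hU hUC
  have hCeq : (D 0 + D 1) / 2 = C := by rw [← hUC, hI1, hI2, min_self]
  have hgrad1 : ∀ v, gradI Pstar W1 v = (∑ u, v (0, u)) * D 0 + (∑ u, v (1, u)) * D 1 :=
    fun v => by rw [← havg1, gradI, ← hPU]
  have hgrad2 : ∀ v, gradI Pstar W2 v = (∑ u, v (0, u)) * D 1 + (∑ u, v (1, u)) * D 0 :=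
    fun v => by rw [← havg2, gradI, ← hPU, hq2]
  have hDne : D 0 ≠ D 1 := by
    intro h
    refine hC1gt.not_ge (hC1.2 ?_)
    rintro s ⟨P, hP, rfl⟩
    refine mutInfo_le_of_relEnt_le hP hW1 hW1sum hq hqsum hdom1 ?_
    rintro ⟨k, u⟩
    fin_cases k
    · exact (hD1a u).trans_le (by linarith)
    · exact (hD1b u).trans_le (by linarith)
  refine ⟨fun v hv => ?_, fun η _ hη => ?_⟩
  · rw [hgrad1, hgrad2]
    rw [hsplit] at hv
    linear_combination (D 0 + D 1) * hv
  · have hN0 : (N : ℝ) ≠ 0 := by positivity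
    have h := hη (fun x => if x.1 = 0 then 1 else -1) (by simp [hsplit])
    rw [hgrad1, hgrad2] at h
    simp only [if_true, one_ne_zero, if_false, Finset.sum_const, Finset.card_univ,
      Fintype.card_fin, nsmul_eq_mul] at h
    have h' : (N : ℝ) * (D 0 - D 1) * (2 * η - 1) = 0 := by linear_combination h
    have := (mul_eq_zero.mp h').resolve_left (mul_ne_zero hN0 (sub_ne_zero.mpr hDne))
    linarith
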